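/- Let φ be a smooth solution of □φ = f on [0,t] × ℝ³ with sufficient decay, and let u = t - r. Then in the exterior region {r ≥ t}: ∫_{Σ_t ∩ {r ≥ t}} |u|² |∂²φ|² ≤ C [ ∫_{Σ_0} r² |∂²φ|² + ( ∫_0^t ‖u ∂f(s)‖_{L²(Σ_s ∩ {r ≥ s})} ds )² ]. -/

import Mathlib

open MeasureTheory
open scoped BigOperators

noncomputable section

local notation "E3" => EuclideanSpace ℝ (Fin 3)

def pd (v : ℝ × E3) (ψ : ℝ × E3 → ℝ) : ℝ × E3 → ℝ := fun p => fderiv ℝ ψ p v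

/-- Time derivative `∂_t`. -/
def pt : (ℝ × E3 → ℝ) → ℝ × E3 → ℝ := pd (1, 0)

/-- Spatial derivative `∂_i`. -/
def px (i : Fin 3) : (ℝ × E3 → ℝ) → ℝ × E3 → ℝ := pd (0, EuclideanSpace.single i 1)

/-- The wave operator `□ = -∂_t² + Δ`. -/
def box (ψ : ℝ × E3 → ℝ) : ℝ × E3 → ℝ :=
  fun p => -pt (pt ψ) p + ∑ i, px i (px i ψ) p

/-- Squared spacetime gradient `|∂ψ|²`. -/
def gradSq (ψ : ℝ × E3 → ℝ) (p : ℝ × E3) : ℝ :=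
  (pt ψ p) ^ 2 + ∑ i, (px i ψ p) ^ 2

/-- Sum of squares of all second spacetime derivatives `|∂²ψ|²`. -/
def hess2Sq (ψ : ℝ × E3 → ℝ) (p : ℝ × E3) : ℝ :=
  (pt (pt ψ) p) ^ 2 + (∑ i, (pt (px i ψ) p) ^ 2) + (∑ i, (px i (pt ψ) p) ^ 2) +
    ∑ i, ∑ j, (px i (px j ψ) p) ^ 2

/-- The positive-part square `y ↦ (max y 0)²` is differentiable. -/
theorem hasDerivAt_posPart_sq (y : ℝ) :
    HasDerivAt (fun y : ℝ => (max y 0) ^ 2) (2 * max y 0) y := by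
  rcases lt_trichotomy y 0 with hy | rfl | hy
  · rw [max_eq_right hy.le, mul_zero]
    refine (hasDerivAt_const y (0 : ℝ)).congr_of_eventuallyEq ?_
    filter_upwards [gt_mem_nhds hy] with z hz
    simp [max_eq_right hz.le]
  · have h : (fun y : ℝ => (max y 0) ^ 2) =O[nhds 0] fun y => ‖y - 0‖ ^ 2 := by
      refine Asymptotics.IsBigO.of_bound 1 (Filter.Eventually.of_forall fun z => ?_)
      rcases le_total z 0 with hz | hz
      · simp [max_eq_right hz]; positivity
      · simp [max_eq_left hz]
    have := (h.hasFDerivAt one_lt_two).hasDerivAt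
    simpa using this
  · rw [max_eq_left hy.le]
    have : HasDerivAt (fun y : ℝ => y ^ 2) (2 * y) y := by simpa using hasDerivAt_pow 2 y
    refine this.congr_of_eventuallyEq ?_
    filter_upwards [lt_mem_nhds hy] with z hz
    simp [max_eq_left hz.le]

/-- The squared weight `u²`, cut off to the exterior region `{r ≥ s}`. -/
def extWeight (p : ℝ × E3) : ℝ := (max (‖p.2‖ - p.1) 0) ^ 2

theorem continuous_extWeight : Continuous extWeight := by unfold extWeight; fun_prop

theorem extWeight_nonneg (p : ℝ × E3) : 0 ≤ extWeight p := sq_nonneg _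

theorem hasDerivAt_extWeight_time (s : ℝ) (x : E3) :
    HasDerivAt (fun s => extWeight (s, x)) (-(2 * max (‖x‖ - s) 0)) s := by
  have h := (hasDerivAt_posPart_sq (‖x‖ - s)).comp s ((hasDerivAt_id s).const_sub ‖x‖)
  simpa [extWeight, Function.comp_def] using h

theorem hasLineDerivAt_extWeight_space {s : ℝ} (hs : 0 < s) (x : E3) (i : Fin 3) :
    HasLineDerivAt ℝ (fun x => extWeight (s, x))
      (2 * max (‖x‖ - s) 0 * (x i / max ‖x‖ s)) x (EuclideanSpace.single i 1) := by
  rcases lt_or_ge ‖x‖ s with hx | hx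
  · have h0 : HasFDerivAt (fun x : E3 => extWeight (s, x)) (0 : E3 →L[ℝ] ℝ) x := by
      refine (hasFDerivAt_const (0 : ℝ) x).congr_of_eventuallyEq ?_
      filter_upwards [continuous_norm.continuousAt.eventually_lt continuousAt_const hx] with z hz
      simp [extWeight, max_eq_right (sub_nonpos.2 hz.le)]
    simpa [max_eq_right (sub_nonpos.2 hx.le)] using h0.hasLineDerivAt (EuclideanSpace.single i 1)
  · have hpos : 0 < ‖x‖ := hs.trans_le hx
    have hn : HasFDerivAt (fun x : E3 => ‖x‖) (fderiv ℝ (fun x : E3 => ‖x‖) x) x :=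
      ((contDiffAt_norm ℝ (norm_pos_iff.1 hpos)).differentiableAt (n := 1) one_ne_zero).hasFDerivAt
    have hv : fderiv ℝ (fun x : E3 => ‖x‖) x (EuclideanSpace.single i 1) = x i / ‖x‖ := by
      have h1 := hn.pow 2
      have h2 := (hasStrictFDerivAt_norm_sq x).hasFDerivAt
      have h3 := congrArg (fun L => L (EuclideanSpace.single i (1 : ℝ))) (h1.unique h2)
      simp [EuclideanSpace.inner_single_right] at h3
      field_simp
      linarith
    have h := ((hasDerivAt_posPart_sq (‖x‖ - s)).comp_hasFDerivAt x (hn.sub_const s)).hasLineDerivAt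
      (EuclideanSpace.single i 1)
    rw [max_eq_left hx, ← hv]
    simpa [extWeight, Function.comp_def] using h

section Slices

variable {g g' : ℝ × E3 → ℝ}

theorem hasCompactSupport_slice (hc : HasCompactSupport g) (s : ℝ) :
    HasCompactSupport fun x => g (s, x) := by
  refine hc.comp_isClosedEmbedding (g := Prod.mk s) ⟨isEmbedding_prodMkRight s, ?_⟩
  have : Set.range (Prod.mk s : E3 → ℝ × E3) = Prod.fst ⁻¹' {s} := by
    ext ⟨a, b⟩; simp [eq_comm]
  rw [this]
  exact isClosed_singleton.preimage continuous_fst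

theorem integrable_slice (hg : Continuous g) (hc : HasCompactSupport g) (s : ℝ) :
    Integrable fun x => g (s, x) :=
  (hg.comp (Continuous.prodMk_right s)).integrable_of_hasCompactSupport
    (hasCompactSupport_slice hc s)

theorem exists_integrable_slice_bound (hg : Continuous g) (hc : HasCompactSupport g) :
    ∃ b : E3 → ℝ, Integrable b ∧ ∀ s x, ‖g (s, x)‖ ≤ b x := by
  obtain ⟨K, hK⟩ := hg.bounded_above_of_compact_support hc
  have hcomp : IsCompact (Prod.snd '' tsupport g) := hc.isCompact.image continuous_snd
  refine ⟨(Prod.snd '' tsupport g).indicator fun _ => K,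
    (integrable_indicator_iff hcomp.measurableSet).2 (integrableOn_const hcomp.measure_lt_top.ne),
    fun s x => ?_⟩
  by_cases hx : x ∈ Prod.snd '' tsupport g
  · simpa [Set.indicator_of_mem hx] using hK (s, x)
  · have : g (s, x) = 0 := image_eq_zero_of_notMem_tsupport fun h => hx ⟨_, h, rfl⟩
    simp [Set.indicator_of_notMem hx, this]

theorem continuous_integral_slice (hg : Continuous g) (hc : HasCompactSupport g) :
    Continuous fun s => ∫ x, g (s, x) := by
  obtain ⟨b, hb, hbound⟩ := exists_integrable_slice_bound hg hc
  exact continuous_of_dominated (fun s => (integrable_slice hg hc s).aestronglyMeasurable)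
    (fun s => Filter.Eventually.of_forall (hbound s)) hb
    (Filter.Eventually.of_forall fun x => hg.comp (Continuous.prodMk_left x))

theorem hasDerivAt_integral_slice (hg : Continuous g) (hc : HasCompactSupport g)
    (hg' : Continuous g') (hc' : HasCompactSupport g')
    (h : ∀ s x, HasDerivAt (fun s => g (s, x)) (g' (s, x)) s) (s : ℝ) :
    HasDerivAt (fun s => ∫ x, g (s, x)) (∫ x, g' (s, x)) s := by
  obtain ⟨b, hb, hbound⟩ := exists_integrable_slice_bound hg' hc'
  exact (hasDerivAt_integral_of_dominated_loc_of_deriv_le (F := fun s x => g (s, x))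
    (F' := fun s x => g' (s, x)) (s := Set.univ) Filter.univ_mem
    (Filter.Eventually.of_forall fun s => (integrable_slice hg hc s).aestronglyMeasurable)
    (integrable_slice hg hc s) (integrable_slice hg' hc' s).aestronglyMeasurable
    (Filter.Eventually.of_forall fun x s _ => hbound s x) hb
    (Filter.Eventually.of_forall fun x s _ => h s x)).2

theorem integral_lineDeriv_eq_zero {h h' : E3 → ℝ} {v : E3} (hi : Integrable h)
    (hi' : Integrable h') (hd : ∀ x, HasLineDerivAt ℝ h (h' x) x v) : ∫ x, h' x = 0 := by
  have := integral_bilinear_hasLineDerivAt_right_eq_neg_left_of_integrable (μ := volume)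
    (f := fun _ : E3 => (1 : ℝ)) (f' := fun _ => 0) (g := h) (g' := h') (v := v)
    (B := ContinuousLinearMap.mul ℝ ℝ) (by simp) (by simpa using hi') (by simpa using hi)
    (fun x _ => by simpa [HasLineDerivAt] using hasDerivAt_const (0 : ℝ) (1 : ℝ)) (fun x _ => hd x)
  simpa using this

end Slices

section Derivatives

variable {ψ : ℝ × E3 → ℝ}

theorem contDiff_pd (hψ : ContDiff ℝ (⊤ : ℕ∞) ψ) (v : ℝ × E3) : ContDiff ℝ (⊤ : ℕ∞) (pd v ψ) :=
  (hψ.fderiv_right (m := (⊤ : ℕ∞)) (by simp)).clm_apply contDiff_const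

theorem hasCompactSupport_pd (hc : HasCompactSupport ψ) (v : ℝ × E3) :
    HasCompactSupport (pd v ψ) := hc.fderiv_apply ℝ v

theorem pd_comm (hψ : ContDiff ℝ (⊤ : ℕ∞) ψ) (v w : ℝ × E3) : pd v (pd w ψ) = pd w (pd v ψ) := by
  have hd : Differentiable ℝ (fderiv ℝ ψ) :=
    (hψ.fderiv_right (m := (⊤ : ℕ∞)) (by simp)).differentiable (by simp)
  have key (v w : ℝ × E3) (p : ℝ × E3) :
      pd v (pd w ψ) p = fderiv ℝ (fderiv ℝ ψ) p v w := by
    unfold pd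
    rw [fderiv_clm_apply (hd p) (differentiableAt_const w)]
    simp
  ext p
  rw [key, key]
  exact (hψ.contDiffAt.isSymmSndFDerivAt (by
    simpa using (WithTop.coe_le_coe.2 le_top : ((2 : ℕ∞) : WithTop ℕ∞) ≤ ((⊤ : ℕ∞) : WithTop ℕ∞)))) v w

theorem hasDerivAt_time (hψ : ContDiff ℝ (⊤ : ℕ∞) ψ) (s : ℝ) (x : E3) :
    HasDerivAt (fun s => ψ (s, x)) (pt ψ (s, x)) s := by
  have h := (hψ.differentiable (by simp) (s, x)).hasFDerivAt.comp_hasDerivAt s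
    ((hasDerivAt_id s).prodMk (hasDerivAt_const s x))
  exact h

theorem hasLineDerivAt_space (hψ : ContDiff ℝ (⊤ : ℕ∞) ψ) (s : ℝ) (x : E3) (i : Fin 3) :
    HasLineDerivAt ℝ (fun x => ψ (s, x)) (px i ψ (s, x)) x (EuclideanSpace.single i 1) := by
  have h := (hψ.differentiable (by simp) (s, x)).hasFDerivAt.comp x
    ((hasFDerivAt_const s x).prodMk (hasFDerivAt_id x))
  simpa [px, pd, Function.comp_def] using h.hasLineDerivAt (EuclideanSpace.single i 1)

theorem contDiff_box (hψ : ContDiff ℝ (⊤ : ℕ∞) ψ) : ContDiff ℝ (⊤ : ℕ∞) (box ψ) :=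
  (contDiff_pd (contDiff_pd hψ _) _).neg.add
    (ContDiff.sum fun _ _ => contDiff_pd (contDiff_pd hψ _) _)

theorem pd_box (hψ : ContDiff ℝ (⊤ : ℕ∞) ψ) (v : ℝ × E3) : pd v (box ψ) = box (pd v ψ) := by
  have hd (w w' : ℝ × E3) (p : ℝ × E3) : DifferentiableAt ℝ (pd w (pd w' ψ)) p :=
    (contDiff_pd (contDiff_pd hψ _) _).differentiable (by simp) p
  have hcomm (w : ℝ × E3) : pd w (pd w (pd v ψ)) = pd v (pd w (pd w ψ)) := by
    rw [pd_comm hψ w v, pd_comm (contDiff_pd hψ w)]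
  ext p
  have h : HasFDerivAt (box ψ) _ p := (hd (1, 0) (1, 0) p).hasFDerivAt.neg.add
    (HasFDerivAt.fun_sum (u := Finset.univ) fun i _ =>
      (hd (0, EuclideanSpace.single i 1) (0, EuclideanSpace.single i 1) p).hasFDerivAt)
  simp only [box, pt, px, hcomm]
  change fderiv ℝ (box ψ) p v = _
  rw [h.fderiv]
  simp [pd]

theorem pd_eq_zero_of_notMem_tsupport {p : ℝ × E3} (hp : p ∉ tsupport ψ) (v : ℝ × E3) :
    pd v ψ p = 0 := by
  have : fderiv ℝ ψ p = 0 := image_eq_zero_of_notMem_tsupport fun h => hp (tsupport_fderiv_subset ℝ h)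
  simp [pd, this]

theorem tsupport_pd_subset (v : ℝ × E3) : tsupport (pd v ψ) ⊆ tsupport ψ :=
  closure_minimal (fun p hp => by
    by_contra h
    exact hp (pd_eq_zero_of_notMem_tsupport h v)) (isClosed_tsupport ψ)

end Derivatives

section Energy

variable {ψ : ℝ × E3 → ℝ}

theorem continuous_gradSq (hψ : ContDiff ℝ (⊤ : ℕ∞) ψ) : Continuous (gradSq ψ) := by
  have h (v : ℝ × E3) : Continuous (pd v ψ) := (contDiff_pd hψ v).continuous
  unfold gradSq pt px
  fun_prop

theorem hasCompactSupport_gradSq (hc : HasCompactSupport ψ) : HasCompactSupport (gradSq ψ) :=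
  HasCompactSupport.intro hc.isCompact fun p hp => by
    simp [gradSq, pt, px, pd_eq_zero_of_notMem_tsupport hp]

theorem gradSq_nonneg (ψ : ℝ × E3 → ℝ) (p : ℝ × E3) : 0 ≤ gradSq ψ p := by
  unfold gradSq; positivity

/-- `|∂ψ|² + 2 ∂_tψ (ω·∇ψ) ≥ 0` for `|ω| ≤ 1`, in coordinates. -/
theorem sq_add_sum_sq_add_two_mul_nonneg (a : ℝ) (b ω : Fin 3 → ℝ) (hω : ∑ i, ω i ^ 2 ≤ 1) :
    0 ≤ a ^ 2 + ∑ i, b i ^ 2 + 2 * a * ∑ i, ω i * b i := by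
  have h : a ^ 2 + ∑ i, b i ^ 2 + 2 * a * ∑ i, ω i * b i =
      ∑ i, (b i + a * ω i) ^ 2 + a ^ 2 * (1 - ∑ i, ω i ^ 2) := by
    simp only [Fin.sum_univ_three]; ring
  rw [h]
  have := sub_nonneg.2 hω
  positivity

theorem sum_sq_div_max_le_one (x : E3) {s : ℝ} (hs : 0 < s) :
    ∑ i, (x i / max ‖x‖ s) ^ 2 ≤ 1 := by
  have hm : 0 < max ‖x‖ s := lt_max_of_lt_right hs
  simp only [div_pow]
  rw [← Finset.sum_div, div_le_one (by positivity), ← EuclideanSpace.real_norm_sq_eq]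
  gcongr
  exact le_max_left _ _

/-- Energy inequality for the exterior weight: the flux terms have a favourable sign. -/
theorem exists_hasDerivAt_energy_le (hψ : ContDiff ℝ (⊤ : ℕ∞) ψ) (hc : HasCompactSupport ψ)
    {s : ℝ} (hs : 0 < s) :
    ∃ D, HasDerivAt (fun s => ∫ x, extWeight (s, x) * gradSq ψ (s, x)) D s ∧
      D ≤ ∫ x, extWeight (s, x) * (-2 * (pt ψ (s, x) * box ψ (s, x))) := by
  have c1 (v : ℝ × E3) : Continuous (pd v ψ) := (contDiff_pd hψ v).continuous
  have c2 (v w : ℝ × E3) : Continuous (pd v (pd w ψ)) :=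
    (contDiff_pd (contDiff_pd hψ w) v).continuous
  have cb : Continuous (box ψ) := (contDiff_box hψ).continuous
  have cw := continuous_extWeight
  set g' : ℝ × E3 → ℝ := fun p => -(2 * max (‖p.2‖ - p.1) 0) * gradSq ψ p +
    extWeight p * (2 * pt ψ p * pt (pt ψ) p + ∑ i, 2 * px i ψ p * pt (px i ψ) p) with hg'
  have cg : Continuous (gradSq ψ) := continuous_gradSq hψ
  have cg' : Continuous g' := by
    simp only [hg', pt, px]; fun_prop
  have sg' : HasCompactSupport g' := HasCompactSupport.intro hc.isCompact fun p hp => by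
    simp [hg', gradSq, pt, px, pd_eq_zero_of_notMem_tsupport hp]
  have hderiv (s : ℝ) (x : E3) :
      HasDerivAt (fun s => extWeight (s, x) * gradSq ψ (s, x)) (g' (s, x)) s := by
    have ht := (hasDerivAt_time (contDiff_pd hψ (1, 0)) s x).pow 2
    have hx := HasDerivAt.fun_sum (u := Finset.univ) fun i _ =>
      (hasDerivAt_time (contDiff_pd hψ (0, EuclideanSpace.single i 1)) s x).pow 2
    refine ((hasDerivAt_extWeight_time s x).mul (ht.add hx)).congr_deriv ?_
    simp [hg', gradSq, pt, px]
  -- The spatial flux `w ∂_tψ ∂_iψ` and its divergence.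
  let h' (i : Fin 3) (x : E3) : ℝ :=
    2 * max (‖x‖ - s) 0 * (x i / max ‖x‖ s) * (pt ψ (s, x) * px i ψ (s, x)) +
      extWeight (s, x) * (px i (pt ψ) (s, x) * px i ψ (s, x) + pt ψ (s, x) * px i (px i ψ) (s, x))
  have hh'i (i : Fin 3) : Integrable (h' i) := by
    have hm (x : E3) : max ‖x‖ s ≠ 0 := (lt_max_of_lt_right hs).ne'
    refine Continuous.integrable_of_hasCompactSupport ?_ ?_
    · simp only [h', pt, px]
      fun_prop (disch := assumption)
    · refine HasCompactSupport.intro (hc.isCompact.image continuous_snd) fun x hx => ?_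
      have hp : (s, x) ∉ tsupport ψ := fun h => hx ⟨_, h, rfl⟩
      simp [h', pt, px, pd_eq_zero_of_notMem_tsupport hp]
  have hh'0 (i : Fin 3) : ∫ x, h' i x = 0 := by
    refine integral_lineDeriv_eq_zero (v := EuclideanSpace.single i 1)
      (h := fun x => extWeight (s, x) * (pt ψ (s, x) * px i ψ (s, x))) ?_ (hh'i i) fun x => ?_
    · refine integrable_slice (g := fun p => extWeight p * (pt ψ p * px i ψ p)) ?_ ?_ s
      · simp only [pt, px]; fun_prop
      · exact HasCompactSupport.intro hc.isCompact fun p hp => by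
          simp [pt, pd_eq_zero_of_notMem_tsupport hp]
    · have hw := hasLineDerivAt_extWeight_space hs x i
      have ha := hasLineDerivAt_space (contDiff_pd hψ (1, 0)) s x i
      have hb := hasLineDerivAt_space (contDiff_pd hψ (0, EuclideanSpace.single i 1)) s x i
      have := HasDerivAt.mul hw (HasDerivAt.mul ha hb)
      refine HasDerivAt.congr_deriv this ?_
      simp [h', pt, px]
  refine ⟨∫ x, g' (s, x), hasDerivAt_integral_slice (by fun_prop)
    (hasCompactSupport_gradSq hc).mul_left cg' sg' hderiv s, ?_⟩
  have hig' := integrable_slice cg' sg' s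
  have hsum : Integrable fun x => 2 * ∑ i, h' i x :=
    (integrable_finsetSum _ fun i _ => hh'i i).const_mul 2
  have hzero : ∫ x, 2 * ∑ i, h' i x = 0 := by
    rw [integral_const_mul, integral_finsetSum _ fun i _ => hh'i i]
    simp [hh'0]
  have heq : ∫ x, g' (s, x) = ∫ x, (g' (s, x) - 2 * ∑ i, h' i x) := by
    rw [integral_sub hig' hsum, hzero, sub_zero]
  rw [heq]
  refine integral_mono (hig'.sub hsum) ?_ fun x => ?_
  · refine integrable_slice (g := fun p => extWeight p * (-2 * (pt ψ p * box ψ p))) ?_ ?_ s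
    · simp only [pt]; fun_prop
    · exact HasCompactSupport.intro hc.isCompact fun p hp => by
        simp [pt, pd_eq_zero_of_notMem_tsupport hp]
  · have hcomm (i : Fin 3) : pt (px i ψ) = px i (pt ψ) := pd_comm hψ _ _
    have hpos := mul_nonneg (le_max_right (‖x‖ - s) 0)
      (sq_add_sum_sq_add_two_mul_nonneg (pt ψ (s, x)) (fun i => px i ψ (s, x))
        (fun i => x i / max ‖x‖ s) (sum_sq_div_max_le_one x hs))
    simp only [hg', h', hcomm, gradSq, box, Fin.sum_univ_three] at hpos ⊢
    linear_combination 2 * hpos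

end Energy

section Hessian

variable {φ : ℝ × E3 → ℝ}

theorem hess2Sq_eq_sum_gradSq (φ : ℝ × E3 → ℝ) (p : ℝ × E3) :
    hess2Sq φ p = gradSq (pt φ) p + ∑ i, gradSq (px i φ) p := by
  simp only [hess2Sq, gradSq, Fin.sum_univ_three]; ring

theorem continuous_hess2Sq (hφ : ContDiff ℝ (⊤ : ℕ∞) φ) : Continuous (hess2Sq φ) := by
  have h (v : ℝ × E3) : Continuous (gradSq (pd v φ)) := continuous_gradSq (contDiff_pd hφ v)
  rw [funext (hess2Sq_eq_sum_gradSq φ)]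
  unfold pt px
  fun_prop

theorem hasCompactSupport_of_pd_pd {g : ℝ × E3 → ℝ} (hc : HasCompactSupport φ)
    (h : ∀ p, (∀ v w, pd v (pd w φ) p = 0) → g p = 0) : HasCompactSupport g :=
  HasCompactSupport.intro hc.isCompact fun p hp => h p fun v w =>
    pd_eq_zero_of_notMem_tsupport (fun h => hp (tsupport_pd_subset w h)) v

theorem hasCompactSupport_hess2Sq (hc : HasCompactSupport φ) : HasCompactSupport (hess2Sq φ) :=
  hasCompactSupport_of_pd_pd hc fun p hp => by simp [hess2Sq, pt, px, hp]

theorem hasCompactSupport_box (hc : HasCompactSupport φ) : HasCompactSupport (box φ) :=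
  hasCompactSupport_of_pd_pd hc fun p hp => by simp [box, pt, px, hp]

theorem hess2Sq_nonneg (φ : ℝ × E3 → ℝ) (p : ℝ × E3) : 0 ≤ hess2Sq φ p := by
  unfold hess2Sq; positivity

/-- Differential inequality `E' ≤ 2 √E ‖u ∂□φ‖` for `E(s) = ∫ u² |∂²φ|²`. -/
theorem exists_hasDerivAt_hessEnergy_le (hφ : ContDiff ℝ (⊤ : ℕ∞) φ) (hc : HasCompactSupport φ)
    {s : ℝ} (hs : 0 < s) :
    ∃ D, HasDerivAt (fun s => ∫ x, extWeight (s, x) * hess2Sq φ (s, x)) D s ∧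
      D ≤ 2 * √(∫ x, extWeight (s, x) * hess2Sq φ (s, x)) *
        √(∫ x, extWeight (s, x) * gradSq (box φ) (s, x)) := by
  have cF := contDiff_box hφ
  have sF := hasCompactSupport_box hc
  have cw := continuous_extWeight
  have c2 (v w : ℝ × E3) : Continuous (pd v (pd w φ)) :=
    (contDiff_pd (contDiff_pd hφ w) v).continuous
  have cdF (v : ℝ × E3) : Continuous (pd v (box φ)) := (contDiff_pd cF v).continuous
  have cb (v : ℝ × E3) : Continuous (box (pd v φ)) := pd_box hφ v ▸ cdF v
  have chs := continuous_hess2Sq hφ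
  have hgi (v : ℝ × E3) (s : ℝ) : Integrable fun x => extWeight (s, x) * gradSq (pd v φ) (s, x) :=
    have := continuous_gradSq (contDiff_pd hφ v)
    integrable_slice (g := fun p => extWeight p * gradSq (pd v φ) p) (by fun_prop)
      (hasCompactSupport_gradSq (hasCompactSupport_pd hc v)).mul_left s
  have hbi (v : ℝ × E3) : Integrable fun x =>
      extWeight (s, x) * (-2 * (pt (pd v φ) (s, x) * box (pd v φ) (s, x))) := by
    refine integrable_slice (g := fun p => extWeight p * (-2 * (pt (pd v φ) p * box (pd v φ) p)))
      (by simp only [pt]; fun_prop) (hasCompactSupport_of_pd_pd hc fun p hp => ?_) s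
    simp [pt, hp]
  choose D hD hDle using fun v : ℝ × E3 =>
    exists_hasDerivAt_energy_le (contDiff_pd hφ v) (hasCompactSupport_pd hc v) hs
  let e (i : Fin 3) : ℝ × E3 := (0, EuclideanSpace.single i 1)
  have hsplit : (fun s => ∫ x, extWeight (s, x) * hess2Sq φ (s, x)) = fun s =>
      (∫ x, extWeight (s, x) * gradSq (pd (1, 0) φ) (s, x)) +
        ∑ i, ∫ x, extWeight (s, x) * gradSq (pd (e i) φ) (s, x) := by
    ext s
    rw [← integral_finsetSum _ fun i _ => hgi (e i) s,
      ← integral_add (hgi _ s) (integrable_finsetSum _ fun i _ => hgi (e i) s)]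
    simp only [hess2Sq_eq_sum_gradSq, mul_add, Finset.mul_sum]
    rfl
  refine ⟨D (1, 0) + ∑ i, D (e i), ?_, ?_⟩
  · rw [hsplit]
    exact (hD _).add (HasDerivAt.fun_sum fun i _ => hD (e i))
  set A := ∫ x, extWeight (s, x) * ((pt (pt φ) (s, x)) ^ 2 + ∑ i, (pt (px i φ) (s, x)) ^ 2) with hA
  set B := ∫ x, extWeight (s, x) * (-2 * (pt (pt φ) (s, x) * pt (box φ) (s, x) +
    ∑ i, pt (px i φ) (s, x) * px i (box φ) (s, x))) with hB
  set G := ∫ x, extWeight (s, x) * gradSq (box φ) (s, x) with hG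
  have hAi : Integrable fun x =>
      extWeight (s, x) * ((pt (pt φ) (s, x)) ^ 2 + ∑ i, (pt (px i φ) (s, x)) ^ 2) := by
    refine integrable_slice (g := fun p =>
      extWeight p * ((pt (pt φ) p) ^ 2 + ∑ i, (pt (px i φ) p) ^ 2))
      (by simp only [pt, px]; fun_prop) (hasCompactSupport_of_pd_pd hc fun p hp => ?_) s
    simp [pt, px, hp]
  have hBi : Integrable fun x => extWeight (s, x) * (-2 * (pt (pt φ) (s, x) * pt (box φ) (s, x) +
      ∑ i, pt (px i φ) (s, x) * px i (box φ) (s, x))) := by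
    refine integrable_slice (g := fun p => extWeight p * (-2 * (pt (pt φ) p * pt (box φ) p +
      ∑ i, pt (px i φ) p * px i (box φ) p)))
      (by simp only [pt, px]; fun_prop) (hasCompactSupport_of_pd_pd hc fun p hp => ?_) s
    simp [pt, px, hp]
  have hGi : Integrable fun x => extWeight (s, x) * gradSq (box φ) (s, x) :=
    have := continuous_gradSq cF
    integrable_slice (g := fun p => extWeight p * gradSq (box φ) p) (by fun_prop)
      (hasCompactSupport_gradSq sF).mul_left s
  have hDB : D (1, 0) + ∑ i, D (e i) ≤ B := by
    refine (add_le_add (hDle _) (Finset.sum_le_sum fun i _ => hDle (e i))).trans_eq ?_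
    rw [← integral_finsetSum _ fun i _ => hbi (e i),
      ← integral_add (hbi _) (integrable_finsetSum _ fun i _ => hbi (e i)), hB]
    congr 1 with x
    simp only [← pd_box hφ, pt, px, e, Fin.sum_univ_three]
    ring
  have hAN : A ≤ ∫ x, extWeight (s, x) * hess2Sq φ (s, x) := by
    refine integral_mono hAi (integrable_slice (g := fun p => extWeight p * hess2Sq φ p)
      (by fun_prop) (hasCompactSupport_hess2Sq hc).mul_left s) fun x => ?_
    refine mul_le_mul_of_nonneg_left ?_ (extWeight_nonneg _)
    unfold hess2Sq
    have h1 : 0 ≤ ∑ i, (px i (pt φ) (s, x)) ^ 2 := by positivity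
    have h2 : 0 ≤ ∑ i, ∑ j, (px i (px j φ) (s, x)) ^ 2 := by positivity
    linarith
  have hdisc : discrim A B G ≤ 0 := discrim_le_zero fun l => by
    rw [mul_comm A, mul_comm B, hA, hB, hG, ← integral_const_mul, ← integral_const_mul,
      ← integral_add (hAi.const_mul _) (hBi.const_mul _),
      ← integral_add ((hAi.const_mul _).fun_add (hBi.const_mul _)) hGi]
    refine integral_nonneg fun x => ?_
    have h : 0 ≤ extWeight (s, x) * ((l * pt (pt φ) (s, x) - pt (box φ) (s, x)) ^ 2 +
        ∑ i, (l * pt (px i φ) (s, x) - px i (box φ) (s, x)) ^ 2) :=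
      mul_nonneg (extWeight_nonneg _) (by positivity)
    simp only [gradSq, Fin.sum_univ_three, Pi.zero_apply] at h ⊢
    linear_combination h
  have hG0 : 0 ≤ G := integral_nonneg fun x => mul_nonneg (extWeight_nonneg _) (gradSq_nonneg _ _)
  refine hDB.trans (abs_le_of_sq_le_sq' ?_ (by positivity)).2
  rw [mul_pow, mul_pow, Real.sq_sqrt hG0, Real.sq_sqrt (integral_nonneg fun x =>
    mul_nonneg (extWeight_nonneg _) (hess2Sq_nonneg _ _))]
  unfold discrim at hdisc
  nlinarith [mul_le_mul_of_nonneg_right hAN hG0]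

end Hessian

/-- Square-root Grönwall inequality: `N' ≤ 2 √N κ` implies `N(t) ≤ 2 (N(0) + (∫ κ)²)`. -/
theorem le_of_hasDerivAt_le_sqrt {N κ : ℝ → ℝ} {t : ℝ} (ht : 0 ≤ t) (hN : ∀ s, 0 ≤ N s)
    (hNc : Continuous N) (hκ : Continuous κ) (hκ0 : ∀ s, 0 ≤ κ s)
    (hD : ∀ s, 0 < s → ∃ D, HasDerivAt N D s ∧ D ≤ 2 * √(N s) * κ s) :
    N t ≤ 2 * (N 0 + (∫ s in (0 : ℝ)..t, κ s) ^ 2) := by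
  have hI : 0 ≤ ∫ s in (0 : ℝ)..t, κ s := intervalIntegral.integral_nonneg ht fun s _ => hκ0 s
  have key (ε : ℝ) (hε : 0 < ε) : √(N t + ε) - √(N 0 + ε) ≤ ∫ s in (0 : ℝ)..t, κ s := by
    choose! D hD hDle using hD
    refine intervalIntegral.sub_le_integral_of_hasDeriv_right_of_le ht
      (g := fun s => √(N s + ε)) (g' := fun s => D s / (2 * √(N s + ε))) (by fun_prop)
      (fun s hs => (((hD s hs.1).add_const ε).sqrt (by linarith [hN s])).hasDerivWithinAt)
      hκ.continuousOn.integrableOn_Icc fun s hs => ?_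
    have hpos : 0 < √(N s + ε) := Real.sqrt_pos.2 (by linarith [hN s])
    rw [div_le_iff₀ (by positivity)]
    refine (hDle s hs.1).trans ?_
    have : √(N s) ≤ √(N s + ε) := Real.sqrt_le_sqrt (by linarith)
    nlinarith [mul_le_mul_of_nonneg_right this (hκ0 s)]
  refine le_of_forall_pos_le_add fun ε hε => ?_
  have h := key ε hε
  have h1 := Real.sq_sqrt (add_nonneg (hN t) hε.le)
  have h2 := Real.sq_sqrt (add_nonneg (hN 0) hε.le)
  nlinarith [sq_nonneg (√(N 0 + ε) - ∫ s in (0 : ℝ)..t, κ s), Real.sqrt_nonneg (N t + ε),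
    Real.sqrt_nonneg (N 0 + ε)]

theorem setIntegral_exterior_eq (h : E3 → ℝ) (s : ℝ) :
    ∫ x in {x : E3 | s ≤ ‖x‖}, (s - ‖x‖) ^ 2 * h x = ∫ x, extWeight (s, x) * h x := by
  rw [← integral_indicator (measurableSet_le measurable_const measurable_norm)]
  congr 1 with x
  by_cases hx : s ≤ ‖x‖
  · rw [Set.indicator_of_mem (by exact hx)]
    simp only [extWeight, max_eq_left (sub_nonneg.2 hx)]
    ring
  · rw [Set.indicator_of_notMem (by exact hx)]
    simp [extWeight, max_eq_right (sub_nonpos.2 (not_le.1 hx).le)]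

/-- Weighted exterior energy estimate with weight `u = t - r`:
`∫_{Σ_t ∩ {r ≥ t}} u² |∂²φ|² ≤ C [∫_{Σ_0} r² |∂²φ|² + (∫_0^t ‖u ∂f(s)‖_{L²(Σ_s ∩ {r ≥ s})} ds)²]`. -/
theorem weighted_exterior_energy_estimate :
    ∃ C : ℝ, 0 < C ∧ ∀ (t : ℝ) (φ f : ℝ × E3 → ℝ), 0 ≤ t →
      ContDiff ℝ (⊤ : ℕ∞) φ → ContDiff ℝ (⊤ : ℕ∞) f → HasCompactSupport φ →
      (∀ p : ℝ × E3, p.1 ∈ Set.Icc 0 t → box φ p = f p) →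
      (∫ x in {x : E3 | t ≤ ‖x‖}, (t - ‖x‖) ^ 2 * hess2Sq φ (t, x)) ≤
        C * ((∫ x : E3, ‖x‖ ^ 2 * hess2Sq φ (0, x)) +
          (∫ s in (0 : ℝ)..t,
            Real.sqrt (∫ x in {x : E3 | s ≤ ‖x‖}, (s - ‖x‖) ^ 2 * gradSq f (s, x))) ^ 2) := by
  refine ⟨2, two_pos, fun t φ f ht hφ _ hc hbox => ?_⟩
  have cw := continuous_extWeight
  have cF := contDiff_box hφ
  have sF := hasCompactSupport_box hc
  have chs := continuous_hess2Sq hφ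
  have cgs := continuous_gradSq cF
  have hinit : ∫ x : E3, ‖x‖ ^ 2 * hess2Sq φ (0, x) =
      ∫ x : E3, extWeight (0, x) * hess2Sq φ (0, x) := by
    simp [extWeight]
  have hforce : (∫ s in (0 : ℝ)..t,
        √(∫ x in {x : E3 | s ≤ ‖x‖}, (s - ‖x‖) ^ 2 * gradSq f (s, x))) =
      ∫ s in (0 : ℝ)..t, √(∫ x, extWeight (s, x) * gradSq (box φ) (s, x)) := by
    rw [intervalIntegral.integral_of_le ht, intervalIntegral.integral_of_le ht,
      integral_Ioc_eq_integral_Ioo, integral_Ioc_eq_integral_Ioo]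
    refine setIntegral_congr_fun measurableSet_Ioo fun s hs => ?_
    have hf (x : E3) : gradSq f (s, x) = gradSq (box φ) (s, x) := by
      have hev : f =ᶠ[nhds (s, x)] box φ := by
        filter_upwards [continuous_fst.continuousAt.preimage_mem_nhds
          (Ioo_mem_nhds hs.1 hs.2)] with p hp
        exact (hbox p ⟨hp.1.le, hp.2.le⟩).symm
      simp only [gradSq, pt, px, pd, hev.fderiv_eq]
    simp only [hf, setIntegral_exterior_eq]
  rw [setIntegral_exterior_eq, hinit, hforce]
  refine le_of_hasDerivAt_le_sqrt (N := fun s => ∫ x, extWeight (s, x) * hess2Sq φ (s, x)) ht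
    (fun s => integral_nonneg fun x => mul_nonneg (extWeight_nonneg _) (hess2Sq_nonneg _ _))
    (continuous_integral_slice (g := fun p => extWeight p * hess2Sq φ p) (by fun_prop)
      (hasCompactSupport_hess2Sq hc).mul_left) ?_ (fun s => Real.sqrt_nonneg _)
    fun s hs => exists_hasDerivAt_hessEnergy_le hφ hc hs
  exact (continuous_integral_slice (g := fun p => extWeight p * gradSq (box φ) p) (by fun_prop)
    (hasCompactSupport_gradSq sF).mul_left).sqrt
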